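/- GHZ states are mergeable: let n = h + m with h ≥ 1 and m ≥ 1. Start from two copies of the GHZ state, Ψ₀(s, t, s', t') := GHZ_n(s ⧺ t) · GHZ_n(s' ⧺ t'), on registers s, s' : Fin h → ZMod 2 and t, t' : Fin m → ZMod 2. Fix outcomes x z₀ : ZMod 2 and an outcome z_u : ZMod 2 for every qubit u of register t other than the last one and every qubit u of register s' other than the first one. Contract the pair of qubits (t_{m−1}, s'_0) with the Bell functional sending the basis pair (0, x) to 1, the basis pair (1, x + 1) to (−1)^{z₀}, and the other two basis pairs to 0; contract every other qubit u of registers t and s' with the functional v ↦ (−1)^{z_u · v} (unnormalized Hadamard-basis projection with outcome z_u). Let Ψ₁ be the resulting vector on registers (s, t') and set z := z₀ + ∑_u z_u (sum in ZMod 2 over all Hadamard outcomes). Then the vector (s, t') ↦ (−1)^{z · (s + x·𝟙)_0} · Ψ₁(s + x·𝟙, t'), obtained by applying Z^z on the first qubit of register s and X^x on every qubit of register s (where 𝟙 is the all-ones vector of length h), is a nonzero complex scalar multiple of GHZ_n on the registers (s, t'). -/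

import Mathlib

open Matrix

/-- The sign `(−1)^u` for `u : ZMod 2`. -/
noncomputable def sgn (u : ZMod 2) : ℂ := if u = 0 then 1 else -1

/-- The GHZ state on `n` qubits: amplitude `2^(−1/2)` on the all-zero and all-one
bit strings, `0` elsewhere. -/
noncomputable def ghz (n : ℕ) (s : Fin n → ZMod 2) : ℂ :=
  if s = 0 ∨ s = fun _ => 1 then (((Real.sqrt 2)⁻¹ : ℝ) : ℂ) else 0

/-- Concatenation of bit vectors along `finSumFinEquiv`. -/
def cat {h m : ℕ} (s : Fin h → ZMod 2) (t : Fin m → ZMod 2) : Fin (h + m) → ZMod 2 :=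
  fun i => Sum.elim s t (finSumFinEquiv.symm i)

/-- The Bell functional with outcomes `(z₀, x)`: it sends the basis pair `(0, x)` to `1`,
the basis pair `(1, x + 1)` to `(−1)^{z₀}`, and the other two basis pairs to `0`. -/
noncomputable def bellF (x z₀ : ZMod 2) (α β : ZMod 2) : ℂ :=
  if β = α + x then sgn (z₀ * α) else 0

theorem zmod2_cases (a : ZMod 2) : a = 0 ∨ a = 1 := by
  revert a; decide

theorem sgn_add (a b : ZMod 2) : sgn (a + b) = sgn a * sgn b := by
  have h2 : (1 + 1 : ZMod 2) = 0 := by decide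
  rcases zmod2_cases a with rfl | rfl <;> rcases zmod2_cases b with rfl | rfl <;>
    simp [sgn, h2]

theorem sgn_sq (a : ZMod 2) : sgn a * sgn a = 1 := by
  unfold sgn; split_ifs <;> simp

theorem sgn_ne_zero (a : ZMod 2) : sgn a ≠ 0 := by
  unfold sgn; split_ifs <;> simp

theorem sgn_sum {ι : Type*} (S : Finset ι) (f : ι → ZMod 2) (a : ZMod 2) :
    ∏ i ∈ S, sgn (f i * a) = sgn ((∑ i ∈ S, f i) * a) := by
  classical
  induction S using Finset.induction_on with
  | empty => simp [sgn]
  | insert i S hi ih => rw [Finset.prod_insert hi, Finset.sum_insert hi, ih, add_mul, sgn_add]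

theorem cat_eq_const {h m : ℕ} (s : Fin h → ZMod 2) (t : Fin m → ZMod 2) (a : ZMod 2) :
    (cat s t = fun _ => a) ↔ (s = fun _ => a) ∧ (t = fun _ => a) := by
  constructor
  · intro H
    constructor
    · funext i
      simpa [cat] using congrFun H (finSumFinEquiv (Sum.inl i))
    · funext i
      simpa [cat] using congrFun H (finSumFinEquiv (Sum.inr i))
  · rintro ⟨rfl, rfl⟩
    funext i
    simp only [cat]
    cases finSumFinEquiv.symm i <;> rfl

theorem ghz_cat {h m : ℕ} (s : Fin h → ZMod 2) (t : Fin m → ZMod 2) :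
    ghz (h + m) (cat s t) =
      if ∃ a : ZMod 2, (s = fun _ => a) ∧ (t = fun _ => a)
        then (((Real.sqrt 2)⁻¹ : ℝ) : ℂ) else 0 := by
  unfold ghz
  congr 1
  apply propext
  have h0 : (0 : Fin (h + m) → ZMod 2) = fun _ => 0 := rfl
  rw [h0, cat_eq_const, cat_eq_const]
  constructor
  · rintro (H | H)
    exacts [⟨0, H⟩, ⟨1, H⟩]
  · rintro ⟨a, H⟩
    rcases zmod2_cases a with rfl | rfl
    exacts [Or.inl H, Or.inr H]

/-- GHZ states are mergeable: contracting the last qubit of register `t` with the first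
qubit of register `s'` by a Bell functional with outcomes `(x, z₀)` and all other qubits
of `t` and `s'` by Hadamard-basis functionals with outcomes `z_u`, then applying `Z^z`
(with `z` the sum of all outcomes) on the first qubit of `s` and `X^x` on every qubit
of `s`, turns two copies of `GHZ_{h+m}` into `GHZ_{h+m}` on registers `(s, t')`, up to a
nonzero scalar. -/
theorem stmt8 {h m : ℕ} (hh : 0 < h) (hm : 0 < m)
    (x z₀ : ZMod 2) (zt : Fin m → ZMod 2) (zs : Fin h → ZMod 2) :
    let lastM : Fin m := ⟨m - 1, by omega⟩
    let firstH : Fin h := ⟨0, hh⟩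
    -- the all-ones vector of length `h`, scaled by `x`
    let xvec : Fin h → ZMod 2 := fun _ => x
    let z : ZMod 2 := z₀ + (∑ i ∈ Finset.univ.filter (· ≠ lastM), zt i)
        + (∑ i ∈ Finset.univ.filter (· ≠ firstH), zs i)
    let Ψ₁ : (Fin h → ZMod 2) → (Fin m → ZMod 2) → ℂ := fun s t' =>
      ∑ t : Fin m → ZMod 2, ∑ s' : Fin h → ZMod 2,
        bellF x z₀ (t lastM) (s' firstH) *
        (∏ i ∈ Finset.univ.filter (· ≠ lastM), sgn (zt i * t i)) *
        (∏ i ∈ Finset.univ.filter (· ≠ firstH), sgn (zs i * s' i)) *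
        (ghz (h + m) (cat s t) * ghz (h + m) (cat s' t'))
    ∃ γ : ℂ, γ ≠ 0 ∧ ∀ (s : Fin h → ZMod 2) (t' : Fin m → ZMod 2),
      sgn (z * (s + xvec) firstH) * Ψ₁ (s + xvec) t'
        = γ * ghz (h + m) (cat s t') := by
  intro lastM firstH xvec z Ψ₁
  have hxx : x + x = 0 := by revert x; decide
  refine ⟨sgn ((∑ i ∈ Finset.univ.filter (· ≠ firstH), zs i) * x) *
    (((Real.sqrt 2)⁻¹ : ℝ) : ℂ), mul_ne_zero (sgn_ne_zero _) (by simp), ?_⟩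
  intro s t'
  set r := s + xvec with hr
  have key : Ψ₁ r t' = bellF x z₀ (r firstH) (t' lastM) *
        (∏ i ∈ Finset.univ.filter (· ≠ lastM), sgn (zt i * r firstH)) *
        (∏ i ∈ Finset.univ.filter (· ≠ firstH), sgn (zs i * t' lastM)) *
        (ghz (h + m) (cat r fun _ => r firstH) *
          ghz (h + m) (cat (fun _ => t' lastM) t')) := by
    simp only [Ψ₁]
    rw [Finset.sum_eq_single (fun _ => r firstH), Finset.sum_eq_single (fun _ => t' lastM)]
    · intro s' _ hs'
      have : ghz (h + m) (cat s' t') = 0 := by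
        rw [ghz_cat, if_neg]
        rintro ⟨a, rfl, rfl⟩
        exact hs' rfl
      rw [this]; simp
    · simp
    · intro t _ ht
      have : ghz (h + m) (cat r t) = 0 := by
        rw [ghz_cat, if_neg]
        rintro ⟨a, h1, rfl⟩
        exact ht (by rw [h1])
      simp [this]
    · simp
  rw [key, sgn_sum, sgn_sum]
  by_cases H : ∃ b : ZMod 2, (s = fun _ => b) ∧ (t' = fun _ => b)
  · have e : ghz (h + m) (cat s t') = (((Real.sqrt 2)⁻¹ : ℝ) : ℂ) := by
      rw [ghz_cat, if_pos H]
    obtain ⟨b, h1, h2⟩ := H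
    have hrc : r = fun _ => b + x := by rw [hr, h1]; rfl
    have hb : b = b + x + x := by rw [add_assoc, hxx, add_zero]
    have e1 : ghz (h + m) (cat r fun _ => r firstH) = (((Real.sqrt 2)⁻¹ : ℝ) : ℂ) := by
      rw [ghz_cat, if_pos ⟨b + x, hrc, by rw [hrc]⟩]
    have e2 : ghz (h + m) (cat (fun _ => t' lastM) t') = (((Real.sqrt 2)⁻¹ : ℝ) : ℂ) := by
      rw [ghz_cat, if_pos ⟨b, by rw [h2], h2⟩]
    rw [e, e1, e2, hrc, h2]
    simp only [bellF, z]
    rw [if_pos hb]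
    simp only [add_mul, mul_add, sgn_add]
    generalize (∑ i ∈ Finset.univ.filter (· ≠ firstH), zs i) = S
    generalize (∑ i ∈ Finset.univ.filter (· ≠ lastM), zt i) = T
    have q1 := sgn_sq (z₀ * b)
    have q2 := sgn_sq (z₀ * x)
    have q3 := sgn_sq (T * b)
    have q4 := sgn_sq (T * x)
    have q5 := sgn_sq (S * b)
    generalize sgn (z₀ * b) = A1 at *
    generalize sgn (z₀ * x) = A2 at *
    generalize sgn (T * b) = A3 at *
    generalize sgn (T * x) = A4 at *
    generalize sgn (S * b) = A5 at *
    generalize (((Real.sqrt 2)⁻¹ : ℝ) : ℂ) = c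
    generalize sgn (S * x) = A6
    calc _ = (A1 * A1) * (A2 * A2) * (A3 * A3) * (A4 * A4) * (A5 * A5) * (A6 * c * c) := by ring
      _ = _ := by rw [q1, q2, q3, q4, q5]; ring
  · have e : ghz (h + m) (cat s t') = 0 := by rw [ghz_cat, if_neg H]
    rw [e, mul_zero]
    by_cases hB : t' lastM = r firstH + x
    · by_cases hR : r = fun _ => r firstH
      · have e2 : ghz (h + m) (cat (fun _ => t' lastM) t') = 0 := by
          rw [ghz_cat, if_neg]
          rintro ⟨b, -, hb⟩
          apply H
          refine ⟨b, ?_, hb⟩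
          funext i
          have h1 : s i + x = r firstH := congrFun hR i
          have h2 : t' lastM = b := by rw [hb]
          rw [← h2, hB, ← h1, add_assoc, hxx, add_zero]
        rw [e2]; simp
      · have e1 : ghz (h + m) (cat r fun _ => r firstH) = 0 := by
          rw [ghz_cat, if_neg]
          rintro ⟨b, hb, -⟩
          exact hR (by rw [hb])
        rw [e1]; simp
    · simp [bellF, hB]
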